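/- Suppose g is not of type A_{2p}, so that γ(x_K) ∈ Z for all γ ∈ Δ, and let w_K = w_{x_K}. Then the root subsystem Δ_K(0) = {γ ∈ Δ : γ(x_K) = 0} has rank equal to rk g − 1, and the dominant weight −w_K(x_K) is a multiple of a fundamental weight: if w_K(θ) = −α_j ∈ −Π, then −w_K(x_K) = 2ϖ_j/(α_j, α_j) = ϖ_j∨, the fundamental coweight corresponding to α_j. -/

import Mathlib

open scoped RealInnerProductSpace

attribute [local instance] Classical.propDecidable

section RootCombinatorics

variable {V : Type*} [NormedAddCommGroup V] [InnerProductSpace ℝ V]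

/-- The Cartan pairing `⟨γ, α∨⟩ = 2 (γ, α) / (α, α)`. -/
noncomputable def cartanPairing (γ α : V) : ℝ := 2 * ⟪γ, α⟫ / ⟪α, α⟫

/-- The coroot `γ∨ = 2 γ / (γ, γ)`. -/
noncomputable def covec (γ : V) : V := (2 / ⟪γ, γ⟫) • γ

/-- The cascade element `x_K = Σ_{β ∈ K} β / (β, β) = ½ Σ_{β ∈ K} β∨`. -/
noncomputable def cascElt (K : Finset V) : V := ∑ β ∈ K, (⟪β, β⟫)⁻¹ • β

/-- The roots of `S` orthogonal to `β`. -/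
noncomputable def orthSub (S : Finset V) (β : V) : Finset V := S.filter fun γ => ⟪γ, β⟫ = 0

/-- One step of the non-orthogonality (connectedness) relation inside `S`. -/
def connRel (S : Finset V) (a b : V) : Prop := a ∈ S ∧ b ∈ S ∧ ⟪a, b⟫ ≠ 0

/-- The irreducible component of the root subsystem `S` containing `γ`. -/
noncomputable def component (S : Finset V) (γ : V) : Finset V :=
  S.filter fun γ' => Relation.ReflTransGen (connRel S) γ γ'

/-- `C` is an irreducible component of the root subsystem `S`. -/
def IsComponent (S C : Finset V) : Prop := ∃ γ ∈ S, C = component S γ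

end RootCombinatorics

/-- The combinatorial data of an irreducible crystallographic root system with a chosen
system of positive roots, base (set of simple roots) and highest root: the combinatorial
skeleton of a finite-dimensional complex simple Lie algebra, with the Killing-form
identification of the Cartan subalgebra and its dual. -/
structure RootSystemCtx (V : Type*) [NormedAddCommGroup V] [InnerProductSpace ℝ V] where
  /-- the set of roots Δ -/
  Δ : Finset V
  /-- the set of simple roots Π -/
  base : Finset V
  /-- the set of positive roots Δ⁺ -/
  Pos : Finset V
  /-- the highest root θ -/
  θ : V
  zero_not_mem : (0 : V) ∉ Δ
  neg_mem : ∀ γ ∈ Δ, -γ ∈ Δ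
  reflect_mem : ∀ α ∈ Δ, ∀ γ ∈ Δ, γ - cartanPairing γ α • α ∈ Δ
  pairing_int : ∀ α ∈ Δ, ∀ γ ∈ Δ, ∃ k : ℤ, cartanPairing γ α = (k : ℝ)
  span_eq : Submodule.span ℝ (Δ : Set V) = ⊤
  base_subset : base ⊆ Pos
  base_indep : LinearIndependent ℝ (fun a : {x // x ∈ base} => (a : V))
  pos_subset : Pos ⊆ Δ
  pos_or_neg : ∀ γ ∈ Δ, γ ∈ Pos ∨ -γ ∈ Pos
  pos_not_neg : ∀ γ ∈ Pos, -γ ∉ Pos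
  pos_coords : ∀ γ ∈ Pos, γ ∈ AddSubmonoid.closure (base : Set V)
  irreducible : ∀ S : Finset V, S ⊆ Δ → S.Nonempty →
    (∀ a ∈ S, ∀ b ∈ Δ, b ∉ S → ⟪a, b⟫ = 0) → S = Δ
  theta_mem : θ ∈ Pos
  theta_highest : ∀ γ ∈ Δ, θ - γ ∈ AddSubmonoid.closure (base : Set V)

namespace RootSystemCtx

variable {V : Type*} [NormedAddCommGroup V] [InnerProductSpace ℝ V]

variable (ctx : RootSystemCtx V)

/-- The root order `γ ≼ γ'` on roots: `γ' - γ` is a nonnegative integral combination of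
simple roots. -/
def rootLE (γ γ' : V) : Prop := γ' - γ ∈ AddSubmonoid.closure (ctx.base : Set V)

/-- `β` is the highest root of the root subsystem `S` (with respect to the ambient positive
system). -/
def IsHighest (S : Finset V) (β : V) : Prop :=
  β ∈ S ∧ β ∈ ctx.Pos ∧ ∀ γ ∈ S, ctx.rootLE γ β

/-- `CascadeMem ctx S β` : the pair (root subsystem `S = Δ⟨i⟩`, its highest root `β = βᵢ`)
occurs in the recursive construction of the Kostant cascade: one starts with `(Δ, θ)`, and the
descendants of `(S, β)` are the pairs `(C, β')` where `C` is an irreducible component of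
`{γ ∈ S | (γ, β) = 0}` and `β'` is the highest root of `C`. -/
inductive CascadeMem : Finset V → V → Prop
  | top : CascadeMem ctx.Δ ctx.θ
  | step {S C : Finset V} {β β' : V} : CascadeMem S β →
      IsComponent (orthSub S β) C → ctx.IsHighest C β' → CascadeMem C β'

/-- `K` is the Kostant cascade of the root system. -/
def IsCascade (K : Finset V) : Prop := ∀ β, β ∈ K ↔ ∃ S, ctx.CascadeMem S β

/-- The Heisenberg subset `H_β = {γ ∈ S ∩ Δ⁺ : (γ, β) > 0}` attached to a cascade pair
`(S, β)`. -/
noncomputable def heis (S : Finset V) (β : V) : Finset V :=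
  S.filter fun γ => γ ∈ ctx.Pos ∧ 0 < ⟪γ, β⟫

/-- A root is long if it has the same length as the highest root. -/
def IsLong (γ : V) : Prop := ⟪γ, γ⟫ = ⟪ctx.θ, ctx.θ⟫

/-- The highest root `θ` is a fundamental weight. -/
def ThetaFundamental : Prop :=
  ∃ α ∈ ctx.base, cartanPairing ctx.θ α = 1 ∧
    ∀ β ∈ ctx.base, β ≠ α → cartanPairing ctx.θ β = 0

/-- `β'` is a descendant of the cascade element `β`. -/
def Desc (β β' : V) : Prop :=
  ∃ S C, ctx.CascadeMem S β ∧ IsComponent (orthSub S β) C ∧ ctx.IsHighest C β'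

/-- The cascade poset order: `β ≤ β'` iff `β` is an iterated descendant of `β'`. -/
def cascLE (β β' : V) : Prop := Relation.ReflTransGen (fun a b => ctx.Desc b a) β β'

/-- A simple reflection of the root system. -/
def IsSimpleReflection (w : V ≃ₗ[ℝ] V) : Prop :=
  ∃ α ∈ ctx.base, ∀ v, w v = v - (2 * ⟪v, α⟫ / ⟪α, α⟫) • α

/-- The Weyl group, generated by the simple reflections. -/
def weylGroup : Subgroup (V ≃ₗ[ℝ] V) := Subgroup.closure {w | ctx.IsSimpleReflection w}

/-- The length of a Weyl group element: the minimal number of simple reflections needed to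
express it. -/
noncomputable def length (w : V ≃ₗ[ℝ] V) : ℕ :=
  sInf {n | ∃ l : List (V ≃ₗ[ℝ] V), l.length = n ∧
    (∀ s ∈ l, ctx.IsSimpleReflection s) ∧ l.prod = w}

/-- The root system is of type `Aₙ` (Cartan matrix characterisation). -/
def IsTypeA (n : ℕ) : Prop :=
  1 ≤ n ∧ ∃ e : Fin n ≃ {x // x ∈ ctx.base}, ∀ i j : Fin n,
    cartanPairing (e i : V) (e j : V) =
      (if i = j then 2 else if i.val + 1 = j.val ∨ j.val + 1 = i.val then -1 else 0)

/-- The root system is of type `Bₙ` (`n ≥ 2`), with the last simple root short. -/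
def IsTypeB (n : ℕ) : Prop :=
  2 ≤ n ∧ ∃ e : Fin n ≃ {x // x ∈ ctx.base}, ∀ i j : Fin n,
    cartanPairing (e i : V) (e j : V) =
      (if i = j then 2
       else if i.val + 2 = n ∧ j.val + 1 = n then -2
       else if i.val + 1 = j.val ∨ j.val + 1 = i.val then -1 else 0)

/-- The root system is of type `Cₙ` (`n ≥ 2`), with the last simple root long. -/
def IsTypeC (n : ℕ) : Prop :=
  2 ≤ n ∧ ∃ e : Fin n ≃ {x // x ∈ ctx.base}, ∀ i j : Fin n,
    cartanPairing (e i : V) (e j : V) =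
      (if i = j then 2
       else if i.val + 1 = n ∧ j.val + 2 = n then -2
       else if i.val + 1 = j.val ∨ j.val + 1 = i.val then -1 else 0)

/-- The root system is of type `G₂` (first simple root short). -/
def IsTypeG2 : Prop :=
  ∃ e : Fin 2 ≃ {x // x ∈ ctx.base},
    cartanPairing (e 0 : V) (e 0 : V) = 2 ∧ cartanPairing (e 1 : V) (e 1 : V) = 2 ∧
    cartanPairing (e 0 : V) (e 1 : V) = -1 ∧ cartanPairing (e 1 : V) (e 0 : V) = -3

/-- The set of roots `Δ(a_z) = w(Δ⁺_z(-1)) ∪ w(-Δ⁺_z(2))` of the abelian ideal attached by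
Kostant's construction to `z` (with `w = w_z`). -/
def idealSet (w : V ≃ₗ[ℝ] V) (x : V) : Set V :=
  {δ | ∃ γ ∈ ctx.Pos, (⟪γ, x⟫ = -1 ∧ δ = w γ) ∨ (⟪γ, x⟫ = 2 ∧ δ = -(w γ))}

end RootSystemCtx

section Pairing

variable {V : Type*} [NormedAddCommGroup V] [InnerProductSpace ℝ V]

lemma inner_self_pos_of_ne_zero {a : V} (ha : a ≠ 0) : 0 < ⟪a, a⟫ :=
  real_inner_self_pos.2 ha

lemma cartanPairing_mul_inner_self (γ : V) {a : V} (ha : a ≠ 0) :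
    cartanPairing γ a * ⟪a, a⟫ = 2 * ⟪γ, a⟫ := by
  have := inner_self_pos_of_ne_zero ha
  unfold cartanPairing
  field_simp

lemma cartanPairing_self {a : V} (ha : a ≠ 0) : cartanPairing a a = 2 := by
  have := inner_self_pos_of_ne_zero ha
  unfold cartanPairing
  field_simp

lemma cartanPairing_add (γ δ a : V) :
    cartanPairing (γ + δ) a = cartanPairing γ a + cartanPairing δ a := by
  unfold cartanPairing
  rw [inner_add_left]
  ring

lemma cartanPairing_sub (γ δ a : V) :
    cartanPairing (γ - δ) a = cartanPairing γ a - cartanPairing δ a := by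
  unfold cartanPairing
  rw [inner_sub_left]
  ring

lemma cartanPairing_neg (γ a : V) : cartanPairing (-γ) a = -cartanPairing γ a := by
  unfold cartanPairing
  rw [inner_neg_left]
  ring

lemma cartanPairing_smul (c : ℝ) (γ a : V) :
    cartanPairing (c • γ) a = c * cartanPairing γ a := by
  unfold cartanPairing
  rw [real_inner_smul_left]
  ring

lemma cartanPairing_eq_zero_of_inner {γ a : V} (h : ⟪γ, a⟫ = 0) : cartanPairing γ a = 0 := by
  simp [cartanPairing, h]

lemma cartanPairing_pos_iff {γ a : V} (ha : a ≠ 0) : 0 < cartanPairing γ a ↔ 0 < ⟪γ, a⟫ := by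
  have := inner_self_pos_of_ne_zero ha
  unfold cartanPairing
  rw [div_pos_iff_of_pos_right this]
  constructor <;> intro h <;> linarith

lemma cartanPairing_neg_iff {γ a : V} (ha : a ≠ 0) : cartanPairing γ a < 0 ↔ ⟪γ, a⟫ < 0 := by
  have h := cartanPairing_pos_iff (γ := -γ) ha
  rw [cartanPairing_neg, inner_neg_left] at h
  constructor <;> intro h' <;> [have := h.1 (by linarith); have := h.2 (by linarith)] <;> linarith

/-- Twice the value of `γ` at the cascade element is the sum of the pairings with the cascade. -/
lemma two_mul_inner_cascElt (K : Finset V) (γ : V) :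
    2 * ⟪γ, cascElt K⟫ = ∑ β ∈ K, cartanPairing γ β := by
  unfold cascElt cartanPairing
  rw [inner_sum, Finset.mul_sum]
  refine Finset.sum_congr rfl fun β _ => ?_
  rw [real_inner_smul_right]
  ring

end Pairing

section Components

variable {V : Type*} [NormedAddCommGroup V] [InnerProductSpace ℝ V]

lemma component_subset (S : Finset V) (γ : V) : component S γ ⊆ S :=
  Finset.filter_subset _ _

lemma mem_component_self {S : Finset V} {γ : V} (h : γ ∈ S) : γ ∈ component S γ :=
  Finset.mem_filter.2 ⟨h, Relation.ReflTransGen.refl⟩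

lemma mem_component_of_inner_ne_zero {S : Finset V} {γ a b : V} (ha : a ∈ component S γ)
    (hb : b ∈ S) (hab : ⟪a, b⟫ ≠ 0) : b ∈ component S γ := by
  obtain ⟨haS, hpath⟩ := Finset.mem_filter.1 ha
  exact Finset.mem_filter.2 ⟨hb, hpath.tail ⟨haS, hb, hab⟩⟩

lemma connRel_symm {S : Finset V} {a b : V} (h : connRel S a b) : connRel S b a :=
  ⟨h.2.1, h.1, by rw [real_inner_comm]; exact h.2.2⟩

/-- A component is connected for the non-orthogonality relation. -/
lemma component_connected {S : Finset V} {γ : V} {T : Finset V} (hT : T ⊆ component S γ)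
    (hne : T.Nonempty) (hclosed : ∀ a ∈ T, ∀ b ∈ component S γ, b ∉ T → ⟪a, b⟫ = 0) :
    T = component S γ := by
  obtain ⟨t, ht⟩ := hne
  refine Finset.Subset.antisymm hT fun c hc => ?_
  have hγt := (Finset.mem_filter.1 (hT ht)).2
  have hγc := (Finset.mem_filter.1 hc).2
  have htγ : Relation.ReflTransGen (connRel S) t γ :=
    haveI : Std.Symm (connRel S) := ⟨fun _ _ => connRel_symm⟩
    symm hγt
  have htc := htγ.trans hγc
  clear hγc hc
  induction htc with
  | refl => exact ht
  | tail _ hstep ih =>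
    by_contra hnot
    exact hstep.2.2 (hclosed _ ih _
      (mem_component_of_inner_ne_zero (hT ih) hstep.2.1 hstep.2.2) hnot)

end Components

namespace RootSystemCtx

variable {V : Type*} [NormedAddCommGroup V] [InnerProductSpace ℝ V]

lemma ne_zero_of_mem (ctx : RootSystemCtx V) {γ : V} (h : γ ∈ ctx.Δ) : γ ≠ 0 := by
  rintro rfl
  exact ctx.zero_not_mem h

lemma exists_height (ctx : RootSystemCtx V) : ∃ h : V →ₗ[ℝ] ℝ, ∀ a ∈ ctx.base, h a = 1 := by
  have hli : LinearIndepOn ℝ id (ctx.base : Set V) := ctx.base_indep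
  let b := Module.Basis.extend hli
  refine ⟨b.constr ℝ fun _ => (1 : ℝ), fun a ha => ?_⟩
  have hmem : a ∈ hli.extend (Set.subset_univ _) := LinearIndepOn.subset_extend _ _ ha
  have hb : b ⟨a, hmem⟩ = a := Module.Basis.extend_apply_self _ _
  conv_lhs => rw [← hb]
  rw [Module.Basis.constr_basis]

lemma height_pos (ctx : RootSystemCtx V) {h : V →ₗ[ℝ] ℝ} (hh : ∀ a ∈ ctx.base, h a = 1) {δ : V}
    (hδ : δ ∈ AddSubmonoid.closure (ctx.base : Set V)) : δ = 0 ∨ 0 < h δ := by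
  induction hδ using AddSubmonoid.closure_induction with
  | mem a ha => right; rw [hh a ha]; norm_num
  | zero => left; rfl
  | add a b _ _ iha ihb =>
    rcases iha with rfl | iha
    · simpa using ihb
    · rcases ihb with rfl | ihb
      · simpa using Or.inr iha
      · right; rw [map_add]; linarith

lemma eq_zero_of_mem_closure (ctx : RootSystemCtx V) {δ : V}
    (h₁ : δ ∈ AddSubmonoid.closure (ctx.base : Set V))
    (h₂ : -δ ∈ AddSubmonoid.closure (ctx.base : Set V)) : δ = 0 := by
  obtain ⟨h, hh⟩ := ctx.exists_height
  rcases ctx.height_pos hh h₁ with h0 | h0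
  · exact h0
  · rcases ctx.height_pos hh h₂ with h3 | h3
    · simpa using h3
    · rw [map_neg] at h3; linarith

lemma mem_pos_of_mem_closure (ctx : RootSystemCtx V) {δ : V} (hδ : δ ∈ ctx.Δ)
    (h : δ ∈ AddSubmonoid.closure (ctx.base : Set V)) : δ ∈ ctx.Pos := by
  rcases ctx.pos_or_neg δ hδ with hp | hp
  · exact hp
  · exact absurd (ctx.eq_zero_of_mem_closure h (ctx.pos_coords _ hp)) (ctx.ne_zero_of_mem hδ)

/-- `S` is an irreducible root subsystem of `Δ`. -/
structure IsIrredSub (ctx : RootSystemCtx V) (S : Finset V) : Prop where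
  subset : S ⊆ ctx.Δ
  reflect : ∀ a ∈ S, ∀ b ∈ S, b - cartanPairing b a • a ∈ S
  connected : ∀ T ⊆ S, T.Nonempty → (∀ a ∈ T, ∀ b ∈ S, b ∉ T → ⟪a, b⟫ = 0) → T = S

lemma isIrredSub_roots (ctx : RootSystemCtx V) : ctx.IsIrredSub ctx.Δ :=
  ⟨Finset.Subset.refl _, ctx.reflect_mem, ctx.irreducible⟩

namespace IsIrredSub

variable {ctx : RootSystemCtx V} {S : Finset V}

lemma ne_zero (hS : ctx.IsIrredSub S) {a : V} (ha : a ∈ S) : a ≠ 0 :=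
  ctx.ne_zero_of_mem (hS.subset ha)

lemma neg_mem (hS : ctx.IsIrredSub S) {a : V} (ha : a ∈ S) : -a ∈ S := by
  have h := hS.reflect a ha a ha
  rw [cartanPairing_self (hS.ne_zero ha)] at h
  convert h using 1
  module

/-- If two distinct roots have positive inner product, then their difference is a root. -/
lemma sub_mem_of_inner_pos (hS : ctx.IsIrredSub S) {a b : V} (ha : a ∈ S) (hb : b ∈ S)
    (hab : 0 < ⟪a, b⟫) (hne : a ≠ b) : a - b ∈ S := by
  obtain ⟨p, hp⟩ := ctx.pairing_int b (hS.subset hb) a (hS.subset ha)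
  obtain ⟨q, hq⟩ := ctx.pairing_int a (hS.subset ha) b (hS.subset hb)
  have hp0 := (cartanPairing_pos_iff (γ := a) (hS.ne_zero hb)).2 hab
  have hq0 := (cartanPairing_pos_iff (γ := b) (hS.ne_zero ha)).2 (by rwa [real_inner_comm])
  have hpm := cartanPairing_mul_inner_self a (hS.ne_zero hb)
  have hqm := cartanPairing_mul_inner_self b (hS.ne_zero ha)
  have hA := inner_self_pos_of_ne_zero (hS.ne_zero ha)
  have hB := inner_self_pos_of_ne_zero (hS.ne_zero hb)
  by_cases hp1 : p = 1
  · have h := hS.reflect b hb a ha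
    rw [hp, hp1] at h
    simpa using h
  by_cases hq1 : q = 1
  · have h := hS.neg_mem (hS.reflect a ha b hb)
    rw [hq, hq1] at h
    simpa using h
  exfalso
  rw [hp] at hp0 hpm
  rw [hq] at hq0 hqm
  have hp2 : (2 : ℝ) ≤ p := by
    have : 0 < p := by exact_mod_cast hp0
    have : 2 ≤ p := by omega
    exact_mod_cast this
  have hq2 : (2 : ℝ) ≤ q := by
    have : 0 < q := by exact_mod_cast hq0
    have : 2 ≤ q := by omega
    exact_mod_cast this
  have hnorm : ⟪a - b, a - b⟫ = ⟪a, a⟫ - 2 * ⟪a, b⟫ + ⟪b, b⟫ := real_inner_sub_sub_self a b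
  rw [real_inner_comm a b] at hqm
  have hpos := inner_self_pos_of_ne_zero (sub_ne_zero.2 hne)
  nlinarith

lemma add_mem_of_inner_neg (hS : ctx.IsIrredSub S) {a b : V} (ha : a ∈ S) (hb : b ∈ S)
    (hab : ⟪a, b⟫ < 0) (hne : a ≠ -b) : a + b ∈ S := by
  have h := hS.sub_mem_of_inner_pos ha (hS.neg_mem hb) (by rw [inner_neg_right]; linarith) hne
  simpa using h

/-- Any two roots of an irreducible root system have a common non-orthogonal root. -/
lemma exists_inner_ne_zero (hS : ctx.IsIrredSub S) {a c : V} (ha : a ∈ S) (hc : c ∈ S) :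
    ∃ b ∈ S, ⟪b, a⟫ ≠ 0 ∧ ⟪b, c⟫ ≠ 0 := by
  have haa := (inner_self_pos_of_ne_zero (hS.ne_zero ha)).ne'
  have key : S.filter (fun c => ∃ b ∈ S, ⟪b, a⟫ ≠ 0 ∧ ⟪b, c⟫ ≠ 0) = S := by
    refine hS.connected _ (Finset.filter_subset _ _)
      ⟨a, Finset.mem_filter.2 ⟨ha, a, ha, haa, haa⟩⟩ fun c hc d hd hdn => ?_
    obtain ⟨hcS, b, hb, hba, hbc⟩ := Finset.mem_filter.1 hc
    by_contra hcd
    apply hdn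
    refine Finset.mem_filter.2 ⟨hd, ?_⟩
    by_cases hca : ⟪c, a⟫ = 0
    · by_cases hbd : ⟪b, d⟫ = 0
      · refine ⟨_, hS.reflect c hcS b hb, ?_, ?_⟩
        · rw [inner_sub_left, real_inner_smul_left, hca]
          simpa using hba
        · rw [inner_sub_left, real_inner_smul_left, hbd, zero_sub, neg_ne_zero]
          refine mul_ne_zero ?_ hcd
          intro h0
          have := cartanPairing_mul_inner_self b (hS.ne_zero hcS)
          rw [h0] at this
          exact hbc (by linarith)
      · exact ⟨b, hb, hba, hbd⟩
    · exact ⟨c, hcS, hca, hcd⟩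
  rw [← key] at hc
  exact (Finset.mem_filter.1 hc).2

/-- An irreducible root subsystem has a highest root. -/
lemma exists_isHighest (hS : ctx.IsIrredSub S) (hne : S.Nonempty) :
    ∃ β, ctx.IsHighest S β := by
  obtain ⟨h, hh⟩ := ctx.exists_height
  let M : V → Prop := fun δ => δ ∈ S ∧ δ ∈ ctx.Pos ∧ ∀ δ' ∈ S, ctx.rootLE δ δ' → δ' = δ
  have above : ∀ γ ∈ S, γ ∈ ctx.Pos → ∃ δ, M δ ∧ ctx.rootLE γ δ := by
    intro γ hγ hγp
    obtain ⟨δ, hδ, hmax⟩ := Finset.exists_max_image (S.filter fun δ => ctx.rootLE γ δ) h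
      ⟨γ, Finset.mem_filter.2 ⟨hγ, by simp [rootLE]⟩⟩
    obtain ⟨hδS, hγδ⟩ := Finset.mem_filter.1 hδ
    have hδp : δ ∈ ctx.Pos := by
      refine ctx.mem_pos_of_mem_closure (hS.subset hδS) ?_
      have := add_mem hγδ (ctx.pos_coords γ hγp)
      simpa using this
    refine ⟨δ, ⟨hδS, hδp, fun δ' hδ' hle => ?_⟩, hγδ⟩
    have hle' : ctx.rootLE γ δ' := by
      have := add_mem hle hγδ
      simpa [rootLE] using this
    have hm := hmax δ' (Finset.mem_filter.2 ⟨hδ', hle'⟩)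
    rcases ctx.height_pos hh hle with h0 | h0
    · exact sub_eq_zero.1 h0
    · rw [map_sub] at h0; linarith
  have dominant : ∀ δ, M δ → ∀ γ ∈ S, γ ∈ ctx.Pos → 0 ≤ ⟪γ, δ⟫ := by
    rintro δ ⟨hδS, hδp, hδm⟩ γ hγ hγp
    by_contra! hlt
    have hne' : δ ≠ -γ := by
      rintro rfl
      exact ctx.pos_not_neg γ hγp hδp
    have hadd := hS.add_mem_of_inner_neg hδS hγ (by rwa [real_inner_comm]) hne'
    have := hδm _ hadd (by simpa [rootLE] using ctx.pos_coords γ hγp)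
    exact hS.ne_zero hγ (by simpa using this)
  have below : ∀ δ, M δ → ∀ γ ∈ S, γ ∈ ctx.Pos → 0 < ⟪γ, δ⟫ → γ ≠ δ →
      δ - γ ∈ S ∧ δ - γ ∈ ctx.Pos := by
    rintro δ ⟨hδS, hδp, hδm⟩ γ hγ hγp hpos hne'
    have hsub := hS.sub_mem_of_inner_pos hδS hγ (by rwa [real_inner_comm]) (Ne.symm hne')
    refine ⟨hsub, ?_⟩
    rcases ctx.pos_or_neg _ (hS.subset hsub) with hp | hp
    · exact hp
    · exact absurd (hδm γ hγ (by simpa [rootLE] using ctx.pos_coords _ hp)) hne'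
  have unique : ∀ δ δ', M δ → M δ' → δ = δ' := by
    intro δ δ' hδ hδ'
    by_contra hne'
    have orth : ⟪δ, δ'⟫ = 0 := by
      refine le_antisymm ?_ (dominant δ' hδ' δ hδ.1 hδ.2.1)
      by_contra! hlt
      have := (below δ' hδ' δ hδ.1 hδ.2.1 hlt hne').2
      exact hne' (hδ.2.2 δ' hδ'.1 (ctx.pos_coords _ this)).symm
    obtain ⟨b, hb, hb1, hb2⟩ := hS.exists_inner_ne_zero hδ.1 hδ'.1
    have wlog_pos : ∃ b ∈ S, b ∈ ctx.Pos ∧ ⟪b, δ⟫ ≠ 0 ∧ ⟪b, δ'⟫ ≠ 0 := by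
      rcases ctx.pos_or_neg b (hS.subset hb) with hp | hp
      · exact ⟨b, hb, hp, hb1, hb2⟩
      · exact ⟨-b, hS.neg_mem hb, hp, by simpa using hb1, by simpa using hb2⟩
    obtain ⟨b, hb, hbp, hb1, hb2⟩ := wlog_pos
    have h1 := lt_of_le_of_ne (dominant δ hδ b hb hbp) hb1.symm
    have h2 := lt_of_le_of_ne (dominant δ' hδ' b hb hbp) hb2.symm
    have hbne : b ≠ δ := by
      rintro rfl
      exact hb2 orth
    obtain ⟨hs, hsp⟩ := below δ hδ b hb hbp h1 hbne
    have := dominant δ' hδ' _ hs hsp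
    rw [inner_sub_left, orth] at this
    linarith
  obtain ⟨s, hs⟩ := hne
  have exists_pos : ∃ s ∈ S, s ∈ ctx.Pos := by
    rcases ctx.pos_or_neg s (hS.subset hs) with hp | hp
    · exact ⟨s, hs, hp⟩
    · exact ⟨-s, hS.neg_mem hs, hp⟩
  obtain ⟨s, hs, hsp⟩ := exists_pos
  obtain ⟨β, hβ, -⟩ := above s hs hsp
  refine ⟨β, hβ.1, hβ.2.1, fun γ hγ => ?_⟩
  rcases ctx.pos_or_neg γ (hS.subset hγ) with hp | hp
  · obtain ⟨δ, hδ, hle⟩ := above γ hγ hp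
    rwa [unique β δ hβ hδ]
  · have := add_mem (ctx.pos_coords _ hβ.2.1) (ctx.pos_coords _ hp)
    simpa [rootLE, sub_eq_add_neg] using this

lemma component_orthSub (hS : ctx.IsIrredSub S) {β γ : V} :
    ctx.IsIrredSub (component (orthSub S β) γ) := by
  have hsub : component (orthSub S β) γ ⊆ orthSub S β := component_subset _ _
  have hsub' : orthSub S β ⊆ S := Finset.filter_subset _ _
  refine ⟨fun a ha => hS.subset (hsub' (hsub ha)), fun a ha b hb => ?_,
    fun T hT hne hcl => component_connected hT hne hcl⟩
  by_cases hab : ⟪b, a⟫ = 0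
  · rw [cartanPairing_eq_zero_of_inner hab]
    simpa using hb
  · have haS := Finset.mem_filter.1 (hsub ha)
    have hbS := Finset.mem_filter.1 (hsub hb)
    refine mem_component_of_inner_ne_zero ha (Finset.mem_filter.2
      ⟨hS.reflect a haS.1 b hbS.1, ?_⟩) ?_
    · rw [inner_sub_left, real_inner_smul_left, haS.2, hbS.2]
      simp
    · rw [inner_sub_right, real_inner_smul_right,
        cartanPairing_mul_inner_self b (hS.ne_zero haS.1), real_inner_comm]
      intro h
      exact hab (by linarith)

end IsIrredSub

namespace IsHighest

variable {ctx : RootSystemCtx V} {S : Finset V} {β : V}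

lemma inner_nonneg (hS : ctx.IsIrredSub S) (hβ : ctx.IsHighest S β) {γ : V} (hγ : γ ∈ S)
    (hγp : γ ∈ ctx.Pos) : 0 ≤ ⟪γ, β⟫ := by
  by_contra! hlt
  have hne' : β ≠ -γ := by
    rintro rfl
    exact ctx.pos_not_neg γ hγp hβ.2.1
  have hadd := hβ.2.2 _ (hS.add_mem_of_inner_neg hβ.1 hγ (by rwa [real_inner_comm]) hne')
  have : -γ ∈ AddSubmonoid.closure (ctx.base : Set V) := by
    simpa [rootLE] using hadd
  exact hS.ne_zero hγ (ctx.eq_zero_of_mem_closure (ctx.pos_coords γ hγp) this)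

lemma sub_mem_pos (hS : ctx.IsIrredSub S) (hβ : ctx.IsHighest S β) {γ : V} (hγ : γ ∈ S)
    (hpos : 0 < ⟪γ, β⟫) (hne : γ ≠ β) : β - γ ∈ ctx.Pos :=
  ctx.mem_pos_of_mem_closure
    (hS.subset (hS.sub_mem_of_inner_pos hβ.1 hγ (by rwa [real_inner_comm]) hne.symm)) (hβ.2.2 γ hγ)

lemma eq_of_isHighest (hβ : ctx.IsHighest S β) {β' : V} (hβ' : ctx.IsHighest S β') : β = β' := by
  have h := ctx.eq_zero_of_mem_closure (hβ.2.2 β' hβ'.1)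
    (by simpa [rootLE] using hβ'.2.2 β hβ.1)
  exact sub_eq_zero.1 h

lemma cartanPairing_eq_one (hS : ctx.IsIrredSub S) (hβ : ctx.IsHighest S β) {γ : V} (hγ : γ ∈ S)
    (hpos : 0 < ⟪γ, β⟫) (hne : γ ≠ β) : cartanPairing γ β = 1 := by
  obtain ⟨p, hp⟩ := ctx.pairing_int β (hS.subset hβ.1) γ (hS.subset hγ)
  have hp0 := (cartanPairing_pos_iff (γ := γ) (hS.ne_zero hβ.1)).2 hpos
  have hp0' : 0 < p := by rw [hp] at hp0; exact_mod_cast hp0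
  by_contra hp1
  have hp2 : 2 ≤ p := by
    have : p ≠ 1 := by
      rintro rfl
      exact hp1 (by simpa using hp)
    omega
  obtain ⟨m, hm⟩ := Int.eq_ofNat_of_zero_le (by omega : 0 ≤ p - 2)
  obtain rfl : p = m + 2 := by omega
  have h1 : β - γ ∈ AddSubmonoid.closure (ctx.base : Set V) := hβ.2.2 γ hγ
  have h2 := hβ.2.2 _ (hS.neg_mem (hS.reflect β hβ.1 γ hγ))
  have h3 : m • β ∈ AddSubmonoid.closure (ctx.base : Set V) :=
    AddSubmonoid.nsmul_mem _ (ctx.pos_coords β hβ.2.1) m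
  have h4 : -(β - γ) ∈ AddSubmonoid.closure (ctx.base : Set V) := by
    have := add_mem h2 h3
    rw [hp] at this
    convert this using 1
    rw [← Nat.cast_smul_eq_nsmul ℝ]
    push_cast
    module
  exact hne (sub_eq_zero.1 (ctx.eq_zero_of_mem_closure h1 h4)).symm

end IsHighest

namespace CascadeMem

variable {ctx : RootSystemCtx V} {S T : Finset V} {β β' : V}

lemma isIrredSub (h : ctx.CascadeMem S β) : ctx.IsIrredSub S := by
  induction h with
  | top => exact ctx.isIrredSub_roots
  | step _ hC _ ih =>
    obtain ⟨γ, _, rfl⟩ := hC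
    exact ih.component_orthSub

lemma isHighest (h : ctx.CascadeMem S β) : ctx.IsHighest S β := by
  cases h with
  | top => exact ⟨ctx.pos_subset ctx.theta_mem, ctx.theta_mem, ctx.theta_highest⟩
  | step _ _ hβ => exact hβ

/-- Two cascade pairs are equal, nested, or orthogonal. -/
lemma trichotomy (hS : ctx.CascadeMem S β) (hT : ctx.CascadeMem T β') :
    (S = T ∧ β = β') ∨ S ⊆ orthSub T β' ∨ T ⊆ orthSub S β ∨
      ∀ a ∈ S, ∀ b ∈ T, ⟪a, b⟫ = 0 := by
  have hsub : ∀ (A : Finset V) (b : V), orthSub A b ⊆ A := fun A b => Finset.filter_subset _ _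
  have hcomp : ∀ {A C : Finset V}, IsComponent A C → C ⊆ A := by
    rintro A C ⟨γ, _, rfl⟩
    exact component_subset _ _
  induction hS generalizing T β' with
  | top =>
    induction hT with
    | top => exact Or.inl ⟨rfl, rfl⟩
    | @step T C b b' hT hC hb ih =>
      refine Or.inr (Or.inr (Or.inl ?_))
      rcases ih with ⟨rfl, rfl⟩ | h | h | h
      · exact hcomp hC
      · have := (Finset.mem_filter.1 (h (hT.isIrredSub.subset hT.isHighest.1))).2
        exact absurd this (inner_self_pos_of_ne_zero (hT.isIrredSub.ne_zero hT.isHighest.1)).ne'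
      · exact fun a ha => h (hsub _ _ (hcomp hC ha))
      · have := h _ (hT.isIrredSub.subset hT.isHighest.1) _ hT.isHighest.1
        exact absurd this (inner_self_pos_of_ne_zero (hT.isIrredSub.ne_zero hT.isHighest.1)).ne'
  | @step S C β γ hS hC hγ ih =>
    have hCmem := hS.step hC hγ
    have hCS : C ⊆ S := fun a ha => hsub _ _ (hcomp hC ha)
    induction hT with
    | top =>
      rcases ih CascadeMem.top with ⟨rfl, rfl⟩ | h | h | h
      · exact Or.inr (Or.inl (hcomp hC))
      · exact Or.inr (Or.inl fun a ha => h (hCS ha))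
      · have := (Finset.mem_filter.1 (h (hS.isIrredSub.subset hS.isHighest.1))).2
        exact absurd this (inner_self_pos_of_ne_zero (hS.isIrredSub.ne_zero hS.isHighest.1)).ne'
      · exact Or.inr (Or.inr (Or.inr fun a ha => h a (hCS ha)))
    | @step T D b δ hT hD hδ ihT =>
      have hDT : D ⊆ T := fun a ha => hsub _ _ (hcomp hD ha)
      rcases ih (hT.step hD hδ) with ⟨rfl, rfl⟩ | h | h | h
      · exact Or.inr (Or.inl (hcomp hC))
      · exact Or.inr (Or.inl fun a ha => h (hCS ha))
      · rcases ihT with ⟨rfl, rfl⟩ | h' | h' | h'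
        · exact Or.inr (Or.inr (Or.inl (hcomp hD)))
        · by_cases hmeet : ∀ a ∈ C, ∀ c ∈ D, ⟪a, c⟫ = 0
          · exact Or.inr (Or.inr (Or.inr hmeet))
          · push Not at hmeet
            obtain ⟨a, ha, c, hc, hac⟩ := hmeet
            obtain ⟨γ₀, _, rfl⟩ := hC
            obtain ⟨δ₀, _, rfl⟩ := hD
            have hcC := mem_component_of_inner_ne_zero ha (h hc) hac
            have hI1 : component (orthSub S β) γ₀ ∩ component (orthSub T b) δ₀ =
                component (orthSub S β) γ₀ :=
              hCmem.isIrredSub.connected _ Finset.inter_subset_left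
                ⟨c, Finset.mem_inter.2 ⟨hcC, hc⟩⟩ fun u hu v hv hvn => by
                  by_contra huv
                  exact hvn (Finset.mem_inter.2 ⟨hv, mem_component_of_inner_ne_zero
                    (Finset.mem_inter.1 hu).2 (h' hv) huv⟩)
            have hI2 : component (orthSub S β) γ₀ ∩ component (orthSub T b) δ₀ =
                component (orthSub T b) δ₀ :=
              (hT.step ⟨δ₀, ‹_›, rfl⟩ hδ).isIrredSub.connected _ Finset.inter_subset_right
                ⟨c, Finset.mem_inter.2 ⟨hcC, hc⟩⟩ fun u hu v hv hvn => by
                  by_contra huv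
                  exact hvn (Finset.mem_inter.2 ⟨mem_component_of_inner_ne_zero
                    (Finset.mem_inter.1 hu).1 (h hv) huv, hv⟩)
            have heq := hI1.symm.trans hI2
            rw [← heq] at hδ
            exact Or.inl ⟨heq, hγ.eq_of_isHighest hδ⟩
        · exact Or.inr (Or.inr (Or.inl fun a ha => h' (hDT ha)))
        · exact Or.inr (Or.inr (Or.inr fun a ha c hc => h' a ha c (hDT hc)))
      · exact Or.inr (Or.inr (Or.inr fun a ha => h a (hCS ha)))

lemma inner_eq_zero (hS : ctx.CascadeMem S β) (hT : ctx.CascadeMem T β') (hne : β ≠ β') :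
    ⟪β, β'⟫ = 0 := by
  rcases hS.trichotomy hT with ⟨_, h⟩ | h | h | h
  · exact absurd h hne
  · exact (Finset.mem_filter.1 (h hS.isHighest.1)).2
  · rw [real_inner_comm]
    exact (Finset.mem_filter.1 (h hT.isHighest.1)).2
  · exact h _ hS.isHighest.1 _ hT.isHighest.1

/-- Every root is non-orthogonal to the highest root of some cascade subsystem containing it. -/
lemma exists_inner_ne_zero (h : ctx.CascadeMem S β) {γ : V} (hγ : γ ∈ S) :
    ∃ T δ, ctx.CascadeMem T δ ∧ γ ∈ T ∧ ⟪γ, δ⟫ ≠ 0 := by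
  induction hn : S.card using Nat.strong_induction_on generalizing S β with
  | _ n ih =>
    by_cases h0 : ⟪γ, β⟫ = 0
    · have hmem : γ ∈ orthSub S β := Finset.mem_filter.2 ⟨hγ, h0⟩
      have hC := mem_component_self hmem
      obtain ⟨δ, hδ⟩ := h.isIrredSub.component_orthSub.exists_isHighest ⟨γ, hC⟩
      have hlt : (component (orthSub S β) γ).card < S.card := by
        refine Finset.card_lt_card ⟨fun a ha => Finset.filter_subset _ _
          (component_subset _ _ ha), fun hss => ?_⟩
        have := (Finset.mem_filter.1 (component_subset _ _ (hss h.isHighest.1))).2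
        exact (inner_self_pos_of_ne_zero (h.isIrredSub.ne_zero h.isHighest.1)).ne' this
      exact ih _ (hn ▸ hlt) (h.step ⟨γ, hmem, rfl⟩ hδ) hC rfl
    · exact ⟨S, β, h, hγ, h0⟩

end CascadeMem

end RootSystemCtx

namespace RootSystemCtx

variable {V : Type*} [NormedAddCommGroup V] [InnerProductSpace ℝ V]

/-- `K` is an orthogonal set of roots whose element `cascElt K` takes integral values, at most
`2`, on all roots. -/
structure IsIntegralFrame (ctx : RootSystemCtx V) (K : Finset V) : Prop where
  mem_roots : ∀ β ∈ K, β ∈ ctx.Δ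
  orthogonal : ∀ β ∈ K, ∀ β' ∈ K, β ≠ β' → ⟪β, β'⟫ = 0
  integral : ∀ γ ∈ ctx.Δ, ∃ k : ℤ, ⟪γ, cascElt K⟫ = k
  le_two : ∀ γ ∈ ctx.Δ, ⟪γ, cascElt K⟫ ≤ 2

lemma inner_cascElt_of_mem (ctx : RootSystemCtx V) {K : Finset V} (hΔ : ∀ β ∈ K, β ∈ ctx.Δ)
    (horth : ∀ β ∈ K, ∀ β' ∈ K, β ≠ β' → ⟪β, β'⟫ = 0) {β : V} (hβ : β ∈ K) :
    ⟪β, cascElt K⟫ = 1 := by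
  have h := two_mul_inner_cascElt K β
  rw [Finset.sum_eq_single β
    (fun b hb hne => cartanPairing_eq_zero_of_inner (horth β hβ b hb hne.symm))
    (fun h => absurd hβ h), cartanPairing_self (ctx.ne_zero_of_mem (hΔ β hβ))] at h
  linarith

namespace IsIntegralFrame

variable {ctx : RootSystemCtx V} {K : Finset V} {β β' : V}

lemma inner_cascElt (F : ctx.IsIntegralFrame K) (hβ : β ∈ K) : ⟪β, cascElt K⟫ = 1 :=
  ctx.inner_cascElt_of_mem F.mem_roots F.orthogonal hβ

lemma cartanPairing_eq_zero (F : ctx.IsIntegralFrame K) (hβ : β ∈ K) (hβ' : β' ∈ K)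
    (hne : β ≠ β') : cartanPairing β β' = 0 :=
  cartanPairing_eq_zero_of_inner (F.orthogonal β hβ β' hβ' hne)

lemma ne_zero (F : ctx.IsIntegralFrame K) (hβ : β ∈ K) : β ≠ 0 :=
  ctx.ne_zero_of_mem (F.mem_roots β hβ)

lemma cartanPairing_self (F : ctx.IsIntegralFrame K) (hβ : β ∈ K) : cartanPairing β β = 2 :=
  _root_.cartanPairing_self (F.ne_zero hβ)

lemma sub_mem (F : ctx.IsIntegralFrame K) {γ : V} (hγ : γ ∈ ctx.Δ) (hβ : β ∈ K)
    (hpos : 0 < cartanPairing γ β) (hne : γ ≠ β) : γ - β ∈ ctx.Δ :=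
  ctx.isIrredSub_roots.sub_mem_of_inner_pos hγ (F.mem_roots β hβ)
    ((cartanPairing_pos_iff (F.ne_zero hβ)).1 hpos) hne

lemma add_mem (F : ctx.IsIntegralFrame K) {γ : V} (hγ : γ ∈ ctx.Δ) (hβ : β ∈ K)
    (hneg : cartanPairing γ β < 0) (hne : γ ≠ -β) : γ + β ∈ ctx.Δ :=
  ctx.isIrredSub_roots.add_mem_of_inner_neg hγ (F.mem_roots β hβ)
    ((cartanPairing_neg_iff (F.ne_zero hβ)).1 hneg) hne

/-- If two pairings with elements of `K` do not account for the value at `cascElt K`, then a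
third element of `K` pairs positively. -/
lemma exists_cartanPairing_pos (hβ : β ∈ K) (hβ' : β' ∈ K) (hne : β ≠ β') {γ : V}
    (h : 0 < 2 * ⟪γ, cascElt K⟫ - cartanPairing γ β - cartanPairing γ β') :
    ∃ δ ∈ K, δ ≠ β ∧ δ ≠ β' ∧ 0 < cartanPairing γ δ := by
  by_contra! hcon
  rw [two_mul_inner_cascElt, ← Finset.add_sum_erase K _ hβ,
    ← Finset.add_sum_erase (K.erase β) _ (Finset.mem_erase.2 ⟨hne.symm, hβ'⟩)] at h
  have : ∑ δ ∈ (K.erase β).erase β', cartanPairing γ δ ≤ 0 := by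
    refine Finset.sum_nonpos fun δ hδ => ?_
    simp only [Finset.mem_erase] at hδ
    exact hcon δ hδ.2.2 hδ.2.1 hδ.1
  linarith

/-- A vector orthogonal to the roots vanishing at `cascElt K` has the same product with two
elements of `K` that pair to `1` and `-1` with such a root. -/
lemma inner_eq_of_cartanPairing (F : ctx.IsIntegralFrame K) {v : V}
    (hv : ∀ γ ∈ ctx.Δ, ⟪γ, cascElt K⟫ = 0 → ⟪γ, v⟫ = 0) (hβ : β ∈ K) (hβ' : β' ∈ K) {b : V}
    (hb : b ∈ ctx.Δ) (h1 : cartanPairing b β = 1) (h2 : cartanPairing b β' = -1)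
    (hx : ⟪b, cascElt K⟫ = 0) : ⟪β, v⟫ = ⟪β', v⟫ := by
  have hne : β ≠ β' := by
    rintro rfl
    rw [h1] at h2
    norm_num at h2
  have hs1 := ctx.reflect_mem β (F.mem_roots β hβ) b hb
  rw [h1, one_smul] at hs1
  have hs2 := ctx.reflect_mem β' (F.mem_roots β' hβ') _ hs1
  rw [cartanPairing_sub, h2, F.cartanPairing_eq_zero hβ hβ' hne] at hs2
  have e1 := hv b hb hx
  have e2 := hv _ hs2 (by
    rw [inner_sub_left, inner_sub_left, real_inner_smul_left, hx, F.inner_cascElt hβ,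
      F.inner_cascElt hβ']
    norm_num)
  rw [inner_sub_left, inner_sub_left, real_inner_smul_left, e1] at e2
  linarith

lemma inner_eq_of_cartanPairing_neg (F : ctx.IsIntegralFrame K) {v : V}
    (hv : ∀ γ ∈ ctx.Δ, ⟪γ, cascElt K⟫ = 0 → ⟪γ, v⟫ = 0) (hβ : β ∈ K) (hβ' : β' ∈ K) {b : V}
    (hb : b ∈ ctx.Δ) (h1 : cartanPairing b β = 1) (h2 : cartanPairing b β' < 0) :
    ⟪β, v⟫ = ⟪β', v⟫ := by
  have hne : β ≠ β' := by
    rintro rfl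
    linarith
  obtain ⟨b, hbmem, hmin⟩ := Finset.exists_min_image
    (ctx.Δ.filter fun b => cartanPairing b β = 1 ∧ cartanPairing b β' < 0)
    (fun b => |⟪b, cascElt K⟫| + |cartanPairing b β'|) ⟨b, Finset.mem_filter.2 ⟨hb, h1, h2⟩⟩
  obtain ⟨hb, h1, h2⟩ := Finset.mem_filter.1 hbmem
  replace hmin : ∀ c ∈ ctx.Δ, cartanPairing c β = 1 → cartanPairing c β' < 0 →
      |⟪b, cascElt K⟫| + |cartanPairing b β'| ≤ |⟪c, cascElt K⟫| + |cartanPairing c β'| :=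
    fun c hc hc1 hc2 => hmin c (Finset.mem_filter.2 ⟨hc, hc1, hc2⟩)
  have ne_of : ∀ c : V, cartanPairing c β = 1 → ∀ δ ∈ K, c ≠ δ ∧ c ≠ -δ := by
    intro c hc δ hδ
    have key : cartanPairing δ β = 0 ∨ cartanPairing δ β = 2 := by
      by_cases h : δ = β
      · exact Or.inr (h ▸ F.cartanPairing_self (h ▸ hδ))
      · exact Or.inl (F.cartanPairing_eq_zero hδ hβ h)
    constructor <;> rintro rfl
    · rcases key with h | h <;> linarith
    · rw [cartanPairing_neg] at hc
      rcases key with h | h <;> linarith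
  obtain ⟨k, hk⟩ := F.integral b hb
  obtain ⟨m, hm⟩ := ctx.pairing_int β' (F.mem_roots β' hβ') b hb
  have hm0 : m < 0 := by
    rw [hm] at h2
    exact_mod_cast h2
  have hadd := F.add_mem hb hβ' h2 (ne_of b h1 β' hβ').2
  have hadd1 : cartanPairing (b + β') β = 1 := by
    rw [cartanPairing_add, h1, F.cartanPairing_eq_zero hβ' hβ hne.symm, add_zero]
  have hadd2 : cartanPairing (b + β') β' = m + 2 := by
    rw [cartanPairing_add, hm, F.cartanPairing_self hβ']
  have haddx : ⟪b + β', cascElt K⟫ = k + 1 := by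
    rw [inner_add_left, hk, F.inner_cascElt hβ']
  have hm2 : -2 ≤ m := by
    by_contra! hlt
    have := hmin _ hadd hadd1 (by rw [hadd2]; exact_mod_cast (by omega : m + 2 < 0))
    rw [haddx, hadd2, hk, hm] at this
    norm_cast at this
    rcases abs_cases k with h | h <;> rcases abs_cases (k + 1) with h' | h' <;>
      rcases abs_cases m with h'' | h'' <;> rcases abs_cases (m + 2) with h''' | h''' <;> omega
  have hk0 : k = 0 := by
    by_contra hk0
    rcases lt_or_gt_of_ne hk0 with hlt | hgt
    · obtain ⟨δ, hδ, hδ1, hδ2, hδpos⟩ := exists_cartanPairing_pos hβ hβ' hne (γ := -b) (by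
        rw [inner_neg_left, cartanPairing_neg, cartanPairing_neg, hk, h1, hm]
        norm_cast
        omega)
      rw [cartanPairing_neg] at hδpos
      have := hmin _ (F.add_mem hb hδ (by linarith) (ne_of b h1 δ hδ).2)
        (by rw [cartanPairing_add, F.cartanPairing_eq_zero hδ hβ hδ1, h1, add_zero])
        (by rw [cartanPairing_add, F.cartanPairing_eq_zero hδ hβ' hδ2, add_zero]; exact h2)
      rw [cartanPairing_add, F.cartanPairing_eq_zero hδ hβ' hδ2, add_zero, inner_add_left, hk,
        F.inner_cascElt hδ] at this
      norm_cast at this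
      have : |k| ≤ |k + 1| := by
        have h' : ((|k| : ℤ) : ℝ) ≤ ((|k + 1| : ℤ) : ℝ) := by linarith
        exact_mod_cast h'
      rcases abs_cases k with h | h <;> rcases abs_cases (k + 1) with h' | h' <;> omega
    · obtain ⟨δ, hδ, hδ1, hδ2, hδpos⟩ := exists_cartanPairing_pos hβ hβ' hne (γ := b) (by
        rw [hk, h1, hm]
        norm_cast
        omega)
      have := hmin _ (F.sub_mem hb hδ hδpos (ne_of b h1 δ hδ).1)
        (by rw [cartanPairing_sub, F.cartanPairing_eq_zero hδ hβ hδ1, h1, sub_zero])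
        (by rw [cartanPairing_sub, F.cartanPairing_eq_zero hδ hβ' hδ2, sub_zero]; exact h2)
      rw [cartanPairing_sub, F.cartanPairing_eq_zero hδ hβ' hδ2, sub_zero, inner_sub_left, hk,
        F.inner_cascElt hδ] at this
      norm_cast at this
      have : |k| ≤ |k - 1| := by
        have h' : ((|k| : ℤ) : ℝ) ≤ ((|k - 1| : ℤ) : ℝ) := by linarith
        exact_mod_cast h'
      rcases abs_cases k with h | h <;> rcases abs_cases (k - 1) with h' | h' <;> omega
  subst hk0
  obtain rfl | rfl : m = -1 ∨ m = -2 := by omega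
  · exact F.inner_eq_of_cartanPairing hv hβ hβ' hb h1 (by rw [hm]; norm_num)
      (by rw [hk]; norm_num)
  obtain ⟨δ, hδ, hδ1, hδ2, hδpos⟩ := exists_cartanPairing_pos hβ hβ' hne (γ := b) (by
    rw [hk, h1, hm]
    norm_num)
  obtain ⟨q, hq⟩ := ctx.pairing_int δ (F.mem_roots δ hδ) b hb
  have hq0 : 0 < q := by
    rw [hq] at hδpos
    exact_mod_cast hδpos
  have hδadd : cartanPairing (b + β') δ = q := by
    rw [cartanPairing_add, hq, F.cartanPairing_eq_zero hβ' hδ hδ2.symm, add_zero]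
  set c := b + β' - δ with hc
  have hcmem : c ∈ ctx.Δ := F.sub_mem hadd hδ (by rw [hδadd]; exact_mod_cast hq0)
    (ne_of _ hadd1 δ hδ).1
  have hc1 : cartanPairing c β = 1 := by
    rw [hc, cartanPairing_sub, hadd1, F.cartanPairing_eq_zero hδ hβ hδ1, sub_zero]
  have hc2 : cartanPairing c β' = 0 := by
    rw [hc, cartanPairing_sub, hadd2, F.cartanPairing_eq_zero hδ hβ' hδ2]
    norm_num
  have hc3 : cartanPairing c δ = q - 2 := by
    rw [hc, cartanPairing_sub, hδadd, F.cartanPairing_self hδ]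
  have hcx : ⟪c, cascElt K⟫ = 0 := by
    rw [hc, inner_sub_left, haddx, F.inner_cascElt hδ]
    norm_num
  have hvδ : ⟪β', v⟫ = ⟪δ, v⟫ := by
    have e1 := hv c hcmem hcx
    have e2 := hv b hb (by rw [hk]; norm_num)
    rw [hc, inner_sub_left, inner_add_left, e2] at e1
    linarith
  have hq1 : q = 1 := by
    by_contra hq1
    have hq2 : (2 : ℝ) ≤ q := by exact_mod_cast (by omega : 2 ≤ q)
    obtain ⟨ε, hε, hε1, hε2, hεpos⟩ := exists_cartanPairing_pos hβ hβ' hne (γ := -c) (by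
      rw [inner_neg_left, cartanPairing_neg, cartanPairing_neg, hcx, hc1, hc2]
      norm_num)
    rw [cartanPairing_neg] at hεpos
    have hε3 : ε ≠ δ := by
      rintro rfl
      linarith
    have hs1 := ctx.reflect_mem β' (F.mem_roots β' hβ') b hb
    have hs2 := ctx.reflect_mem ε (F.mem_roots ε hε) _ hs1
    have hbε : cartanPairing (b - cartanPairing b β' • β') ε = cartanPairing c ε := by
      rw [hc, cartanPairing_sub, cartanPairing_sub, cartanPairing_smul, cartanPairing_add,
        F.cartanPairing_eq_zero hβ' hε hε2.symm, F.cartanPairing_eq_zero hδ hε hε3.symm]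
      ring
    obtain ⟨r, hr⟩ := ctx.pairing_int ε (F.mem_roots ε hε) c hcmem
    rw [hr] at hεpos
    have hr1 : (r : ℝ) ≤ -1 := by
      have h0 : r < 0 := by
        have : (r : ℝ) < 0 := by linarith
        exact_mod_cast this
      exact_mod_cast (by omega : r ≤ -1)
    have := F.le_two _ hs2
    rw [hbε, inner_sub_left, inner_sub_left, real_inner_smul_left, real_inner_smul_left, hk, hm,
      F.inner_cascElt hβ', F.inner_cascElt hε, hr] at this
    norm_num at this
    have hr0 : (0 : ℝ) ≤ r := by exact_mod_cast this
    linarith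
  rw [hvδ]
  exact F.inner_eq_of_cartanPairing hv hβ hδ hcmem hc1 (by rw [hc3, hq1]; norm_num) hcx

/-- A vector orthogonal to the roots vanishing at `cascElt K` and taking a constant value on `K`
is proportional to `cascElt K`. -/
lemma eq_smul_cascElt (F : ctx.IsIntegralFrame K) {v : V} {c : ℝ}
    (hv : ∀ γ ∈ ctx.Δ, ⟪γ, cascElt K⟫ = 0 → ⟪γ, v⟫ = 0) (hc : ∀ β ∈ K, ⟪β, v⟫ = c) :
    v = c • cascElt K := by
  have hnat : ∀ n : ℕ, ∀ γ ∈ ctx.Δ, ⟪γ, cascElt K⟫ = n → ⟪γ, v - c • cascElt K⟫ = 0 := by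
    intro n
    induction n with
    | zero =>
      intro γ hγ h0
      rw [Nat.cast_zero] at h0
      rw [inner_sub_right, real_inner_smul_right, hv γ hγ h0, h0]
      ring
    | succ n ih =>
      intro γ hγ hn
      have hsum := two_mul_inner_cascElt K γ
      obtain ⟨β, hβ, hpos⟩ : ∃ β ∈ K, 0 < cartanPairing γ β := by
        by_contra! hcon
        have := Finset.sum_nonpos hcon
        rw [← hsum, hn] at this
        push_cast at this
        linarith [(Nat.cast_nonneg n : (0 : ℝ) ≤ n)]
      have hβ0 : ⟪β, v - c • cascElt K⟫ = 0 := by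
        rw [inner_sub_right, real_inner_smul_right, hc β hβ, F.inner_cascElt hβ]
        ring
      by_cases hne : γ = β
      · rw [hne, hβ0]
      · have := ih _ (F.sub_mem hγ hβ hpos hne) (by
          rw [inner_sub_left, hn, F.inner_cascElt hβ]
          push_cast
          ring)
        rw [inner_sub_left, hβ0] at this
        linarith
  have hroot : ∀ γ ∈ ctx.Δ, ⟪γ, v - c • cascElt K⟫ = 0 := by
    intro γ hγ
    obtain ⟨k, hk⟩ := F.integral γ hγ
    obtain ⟨n, rfl | rfl⟩ := k.eq_nat_or_neg
    · exact hnat n γ hγ (by simpa using hk)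
    · have := hnat n (-γ) (ctx.neg_mem γ hγ) (by rw [inner_neg_left, hk]; simp)
      rw [inner_neg_left] at this
      linarith
  have hall : ∀ z : V, ⟪z, v - c • cascElt K⟫ = 0 := by
    intro z
    have hz : z ∈ Submodule.span ℝ (ctx.Δ : Set V) := by rw [ctx.span_eq]; trivial
    induction hz using Submodule.span_induction with
    | mem γ hγ => exact hroot γ hγ
    | zero => exact inner_zero_left _
    | add a b _ _ ha hb => rw [inner_add_left, ha, hb, add_zero]
    | smul r a _ ha => rw [real_inner_smul_left, ha, mul_zero]
  exact sub_eq_zero.1 (inner_self_eq_zero.1 (hall _))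

end IsIntegralFrame

/-- A vector orthogonal to the roots vanishing at the cascade element takes a constant value on
the cascade. -/
lemma CascadeMem.inner_eq_inner_theta {ctx : RootSystemCtx V} {K : Finset V}
    (hK : ctx.IsCascade K) (F : ctx.IsIntegralFrame K) {v : V}
    (hv : ∀ γ ∈ ctx.Δ, ⟪γ, cascElt K⟫ = 0 → ⟪γ, v⟫ = 0) {S : Finset V} {β : V}
    (h : ctx.CascadeMem S β) : ⟪β, v⟫ = ⟪ctx.θ, v⟫ := by
  induction h with
  | top => rfl
  | @step S C β γ hS hC hγ ih =>
    have hCmem := hS.step hC hγ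
    have hI := hS.isIrredSub
    obtain ⟨γ₀, _, rfl⟩ := hC
    obtain ⟨hγS, hγβ⟩ := Finset.mem_filter.1 (component_subset _ _ hγ.1)
    obtain ⟨b, hb, hbβ, hbγ⟩ := hI.exists_inner_ne_zero hS.isHighest.1 hγS
    have hβK : β ∈ K := (hK β).2 ⟨_, hS⟩
    have hγK : γ ∈ K := (hK γ).2 ⟨_, hCmem⟩
    obtain ⟨b, hb, hbβ, hbγ⟩ : ∃ b ∈ S, 0 < ⟪b, β⟫ ∧ ⟪b, γ⟫ ≠ 0 := by
      rcases lt_or_gt_of_ne hbβ with hlt | hgt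
      · exact ⟨-b, hI.neg_mem hb, by rw [inner_neg_left]; linarith, by simpa using hbγ⟩
      · exact ⟨b, hb, hgt, hbγ⟩
    have hone := hS.isHighest.cartanPairing_eq_one hI hb hbβ (by
      rintro rfl
      rw [real_inner_comm] at hγβ
      exact hbγ hγβ)
    rw [← ih]
    symm
    rcases lt_or_gt_of_ne hbγ with hlt | hgt
    · exact F.inner_eq_of_cartanPairing_neg hv hβK hγK (hI.subset hb) hone
        ((cartanPairing_neg_iff (F.ne_zero hγK)).2 hlt)
    · have hpos := (cartanPairing_pos_iff (F.ne_zero hγK)).2 hgt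
      refine F.inner_eq_of_cartanPairing_neg hv hβK hγK
        (hI.subset (hI.reflect γ hγS b hb)) ?_ ?_
      · rw [cartanPairing_sub, cartanPairing_smul, cartanPairing_eq_zero_of_inner hγβ, hone]
        ring
      · rw [cartanPairing_sub, cartanPairing_smul, F.cartanPairing_self hγK]
        linarith

/-- The Weyl group permutes the roots and preserves the inner product. -/
lemma weylGroup_mem_roots_iff_and_inner (ctx : RootSystemCtx V) {w : V ≃ₗ[ℝ] V}
    (hw : w ∈ ctx.weylGroup) :
    (∀ γ, w γ ∈ ctx.Δ ↔ γ ∈ ctx.Δ) ∧ ∀ u v, ⟪w u, w v⟫ = ⟪u, v⟫ := by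
  induction hw using Subgroup.closure_induction with
  | mem s hs =>
    obtain ⟨α, hα, hsα⟩ := hs
    have hαΔ := ctx.pos_subset (ctx.base_subset hα)
    have h0 := inner_self_pos_of_ne_zero (ctx.ne_zero_of_mem hαΔ)
    have hmap : ∀ γ ∈ ctx.Δ, s γ ∈ ctx.Δ := fun γ hγ => by
      rw [hsα]
      exact ctx.reflect_mem α hαΔ γ hγ
    have hinv : ∀ v, s (s v) = v := fun v => by
      rw [hsα (s v), hsα v, inner_sub_left, real_inner_smul_left, sub_sub, ← add_smul]
      convert sub_zero v
      convert zero_smul ℝ α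
      field_simp
      ring
    refine ⟨fun γ => ⟨fun h => ?_, hmap γ⟩, fun u v => ?_⟩
    · have := hmap _ h
      rwa [hinv] at this
    · rw [hsα, hsα, inner_sub_left, inner_sub_right, inner_sub_right, real_inner_smul_left,
        real_inner_smul_left, real_inner_smul_right, real_inner_smul_right,
        real_inner_comm v α]
      field_simp
      ring
  | one => exact ⟨fun γ => Iff.rfl, fun u v => rfl⟩
  | mul a b _ _ ha hb =>
    exact ⟨fun γ => (ha.1 (b γ)).trans (hb.1 γ), fun u v => (ha.2 _ _).trans (hb.2 _ _)⟩
  | inv a _ ha =>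
    have hinv : ∀ v, a (a⁻¹ v) = v := fun v => a.apply_symm_apply v
    refine ⟨fun γ => ?_, fun u v => ?_⟩
    · rw [← ha.1, hinv]
    · rw [← ha.2, hinv, hinv]

lemma IsCascade.mem_roots {ctx : RootSystemCtx V} {K : Finset V} (hK : ctx.IsCascade K) :
    ∀ β ∈ K, β ∈ ctx.Δ := by
  intro β hβ
  obtain ⟨S, hS⟩ := (hK β).1 hβ
  exact hS.isIrredSub.subset hS.isHighest.1

lemma IsCascade.orthogonal {ctx : RootSystemCtx V} {K : Finset V} (hK : ctx.IsCascade K) :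
    ∀ β ∈ K, ∀ β' ∈ K, β ≠ β' → ⟪β, β'⟫ = 0 := by
  intro β hβ β' hβ' hne
  obtain ⟨S, hS⟩ := (hK β).1 hβ
  obtain ⟨T, hT⟩ := (hK β').1 hβ'
  exact hS.inner_eq_zero hT hne

lemma IsCascade.theta_mem {ctx : RootSystemCtx V} {K : Finset V} (hK : ctx.IsCascade K) :
    ctx.θ ∈ K :=
  (hK _).2 ⟨_, CascadeMem.top⟩

/-- A positive root outside the cascade is completed to a cascade root by a positive root. -/
lemma IsCascade.exists_sub_mem_pos {ctx : RootSystemCtx V} {K : Finset V}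
    (hK : ctx.IsCascade K) {γ : V} (hγ : γ ∈ ctx.Pos) (hγK : γ ∉ K) :
    ∃ β ∈ K, β - γ ∈ ctx.Pos := by
  obtain ⟨S, β, hS, hγS, hne⟩ := CascadeMem.top.exists_inner_ne_zero (ctx.pos_subset hγ)
  have hβK : β ∈ K := (hK β).2 ⟨S, hS⟩
  have hpos := lt_of_le_of_ne (hS.isHighest.inner_nonneg hS.isIrredSub hγS hγ) hne.symm
  refine ⟨β, hβK, hS.isHighest.sub_mem_pos hS.isIrredSub hγS hpos ?_⟩
  rintro rfl
  exact hγK hβK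

/-- If the positive roots with value `1` or `2` at the cascade element form the inversion set of
a Weyl group element, then all positive roots have value `-1`, `0`, `1` or `2`. -/
lemma IsCascade.inner_cascElt_of_inversions {ctx : RootSystemCtx V} {K : Finset V}
    (hK : ctx.IsCascade K) {w : V ≃ₗ[ℝ] V} (hw : w ∈ ctx.weylGroup)
    (hN : ∀ γ ∈ ctx.Pos,
      (-(w γ) ∈ ctx.Pos ↔ (⟪γ, cascElt K⟫ = 1 ∨ ⟪γ, cascElt K⟫ = 2)))
    {γ : V} (hγ : γ ∈ ctx.Pos) :
    ⟪γ, cascElt K⟫ = -1 ∨ ⟪γ, cascElt K⟫ = 0 ∨ ⟪γ, cascElt K⟫ = 1 ∨ ⟪γ, cascElt K⟫ = 2 := by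
  by_cases hγK : γ ∈ K
  · exact Or.inr (Or.inr (Or.inl (ctx.inner_cascElt_of_mem hK.mem_roots hK.orthogonal hγK)))
  obtain ⟨β, hβ, hsub⟩ := hK.exists_sub_mem_pos hγ hγK
  have hβx := ctx.inner_cascElt_of_mem hK.mem_roots hK.orthogonal hβ
  have hxsub : ⟪β - γ, cascElt K⟫ = 1 - ⟪γ, cascElt K⟫ := by rw [inner_sub_left, hβx]
  have hpos : ∀ δ ∈ ctx.Pos, ¬(⟪δ, cascElt K⟫ = 1 ∨ ⟪δ, cascElt K⟫ = 2) → w δ ∈ ctx.Pos :=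
    fun δ hδ hn => (ctx.pos_or_neg _ (((ctx.weylGroup_mem_roots_iff_and_inner hw).1 δ).2
      (ctx.pos_subset hδ))).resolve_right fun h => hn ((hN δ hδ).1 h)
  by_contra! hcon
  have h1 := hpos γ hγ (by tauto)
  have h2 := hpos _ hsub (by
    rw [hxsub]
    rintro (h | h)
    · exact hcon.2.1 (by linarith)
    · exact hcon.1 (by linarith))
  have hβpos : β ∈ ctx.Pos := by
    obtain ⟨S, hS⟩ := (hK β).1 hβ
    exact hS.isHighest.2.1
  have h3 := (hN β hβpos).2 (Or.inl hβx)
  have h4 := add_mem (ctx.pos_coords _ h1) (ctx.pos_coords _ h2)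
  rw [← map_add, add_sub_cancel] at h4
  have := ctx.eq_zero_of_mem_closure h4 (ctx.pos_coords _ h3)
  rw [LinearEquiv.map_eq_zero_iff] at this
  exact ctx.ne_zero_of_mem (ctx.pos_subset hβpos) this

lemma IsCascade.isIntegralFrame_of_inversions {ctx : RootSystemCtx V} {K : Finset V}
    (hK : ctx.IsCascade K) {w : V ≃ₗ[ℝ] V} (hw : w ∈ ctx.weylGroup)
    (hN : ∀ γ ∈ ctx.Pos,
      (-(w γ) ∈ ctx.Pos ↔ (⟪γ, cascElt K⟫ = 1 ∨ ⟪γ, cascElt K⟫ = 2))) :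
    ctx.IsIntegralFrame K := by
  have hval := fun γ (hγ : γ ∈ ctx.Pos) => hK.inner_cascElt_of_inversions hw hN hγ
  refine ⟨hK.mem_roots, hK.orthogonal, fun γ hγ => ?_, fun γ hγ => ?_⟩
  · have hpos : ∀ δ ∈ ctx.Pos, ∃ k : ℤ, ⟪δ, cascElt K⟫ = k := by
      intro δ hδ
      rcases hval δ hδ with h | h | h | h
      · exact ⟨-1, by rw [h]; norm_num⟩
      · exact ⟨0, by rw [h]; norm_num⟩
      · exact ⟨1, by rw [h]; norm_num⟩
      · exact ⟨2, by rw [h]; norm_num⟩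
    rcases ctx.pos_or_neg γ hγ with h | h
    · exact hpos γ h
    · obtain ⟨k, hk⟩ := hpos _ h
      rw [inner_neg_left] at hk
      exact ⟨-k, by push_cast; linarith⟩
  · rcases ctx.pos_or_neg γ hγ with h | h
    · rcases hval γ h with h | h | h | h <;> linarith
    · rcases hval _ h with h | h | h | h <;> rw [inner_neg_left] at h <;> linarith

/-- The rank of the root system is the number of simple roots. -/
lemma finrank_eq_card_base (ctx : RootSystemCtx V) : Module.finrank ℝ V = ctx.base.card := by
  have hspan : Submodule.span ℝ (ctx.base : Set V) = ⊤ := by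
    rw [eq_top_iff, ← ctx.span_eq, Submodule.span_le]
    have hcl : ∀ δ ∈ AddSubmonoid.closure (ctx.base : Set V),
        δ ∈ Submodule.span ℝ (ctx.base : Set V) := fun δ hδ =>
      (AddSubmonoid.closure_le (S := (Submodule.span ℝ (ctx.base : Set V)).toAddSubmonoid)).2
        Submodule.subset_span hδ
    intro γ hγ
    rcases ctx.pos_or_neg γ hγ with h | h
    · exact hcl γ (ctx.pos_coords γ h)
    · have := Submodule.neg_mem _ (hcl _ (ctx.pos_coords _ h))
      rwa [neg_neg] at this
  have := finrank_span_eq_card ctx.base_indep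
  rw [Subtype.range_coe_subtype] at this
  change Module.finrank ℝ (Submodule.span ℝ (ctx.base : Set V)) = _ at this
  rw [hspan, finrank_top] at this
  simpa using this

end RootSystemCtx

/-- For `g` not of type `A_{2p}`, the root subsystem `Δ_K(0)` has corank one, and the
dominant weight `-w_K(x_K)` is the fundamental coweight `ϖ_j∨ = 2ϖ_j/(α_j, α_j)`, where
`α_j` is the simple root with `w_K(θ) = -α_j`. -/
theorem w_K_casc_fundamental {V : Type*} [NormedAddCommGroup V] [InnerProductSpace ℝ V]
    [FiniteDimensional ℝ V] (ctx : RootSystemCtx V)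
    (K : Finset V) (hK : ctx.IsCascade K)
    (hA : ¬ ∃ p, 1 ≤ p ∧ ctx.IsTypeA (2 * p))
    (w : V ≃ₗ[ℝ] V) (hw : w ∈ ctx.weylGroup)
    (hN : ∀ γ ∈ ctx.Pos,
      (-(w γ) ∈ ctx.Pos ↔ (⟪γ, cascElt K⟫ = 1 ∨ ⟪γ, cascElt K⟫ = 2))) :
    Module.finrank ℝ ↥(Submodule.span ℝ {γ : V | γ ∈ ctx.Δ ∧ ⟪γ, cascElt K⟫ = 0}) =
      ctx.base.card - 1 ∧
    ∀ αj ∈ ctx.base, w ctx.θ = -αj →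
      ∀ ϖ : V, (∀ β ∈ ctx.base, cartanPairing ϖ β = (if β = αj then 1 else 0)) →
        -(w (cascElt K)) = (2 / ⟪αj, αj⟫) • ϖ := by
  have F := hK.isIntegralFrame_of_inversions hw hN
  obtain ⟨hroots, hisom⟩ := ctx.weylGroup_mem_roots_iff_and_inner hw
  have hprop : ∀ v : V, (∀ γ ∈ ctx.Δ, ⟪γ, cascElt K⟫ = 0 → ⟪γ, v⟫ = 0) →
      v = ⟪ctx.θ, v⟫ • cascElt K := fun v hv =>
    F.eq_smul_cascElt hv fun β hβ => by
      obtain ⟨S, hS⟩ := (hK β).1 hβ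
      exact hS.inner_eq_inner_theta hK F hv
  have hθx := F.inner_cascElt hK.theta_mem
  constructor
  · set Z := Submodule.span ℝ {γ : V | γ ∈ ctx.Δ ∧ ⟪γ, cascElt K⟫ = 0} with hZ
    have hperp : Zᗮ = Submodule.span ℝ {cascElt K} := by
      apply le_antisymm
      · intro v hv
        rw [Submodule.mem_span_singleton]
        exact ⟨_, (hprop v fun γ hγ h0 =>
          (Submodule.mem_orthogonal Z v).1 hv γ (Submodule.subset_span ⟨hγ, h0⟩)).symm⟩
      · rw [Submodule.span_singleton_le_iff_mem, Submodule.mem_orthogonal]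
        intro u hu
        induction hu using Submodule.span_induction with
        | mem γ hγ => exact hγ.2
        | zero => exact inner_zero_left _
        | add a b _ _ ha hb => rw [inner_add_left, ha, hb, add_zero]
        | smul r a _ ha => rw [real_inner_smul_left, ha, mul_zero]
    have hne : cascElt K ≠ 0 := by
      intro h
      rw [h, inner_zero_right] at hθx
      norm_num at hθx
    have hsum := Submodule.finrank_add_finrank_orthogonal Z
    rw [hperp, finrank_span_singleton hne, ctx.finrank_eq_card_base] at hsum
    omega
  · intro αj hαj hwθ ϖ hϖ
    have hαj0 := ctx.ne_zero_of_mem (ctx.pos_subset (ctx.base_subset hαj))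
    have hnorm := inner_self_pos_of_ne_zero hαj0
    set y := -(w (cascElt K)) with hy
    have hwy : ∀ γ, ⟪w γ, y⟫ = -⟪γ, cascElt K⟫ := fun γ => by
      rw [hy, inner_neg_right, hisom]
    have hαjy : ⟪αj, y⟫ = 1 := by
      have := hwy ctx.θ
      rw [hwθ, inner_neg_left, hθx] at this
      linarith
    have hdom : ∀ α ∈ ctx.base, 0 ≤ ⟪α, y⟫ := by
      intro α hα
      have hαp := ctx.base_subset hα
      obtain ⟨γ, rfl⟩ := w.surjective α
      have hγ := (hroots γ).1 (ctx.pos_subset hαp)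
      rw [hwy]
      rcases ctx.pos_or_neg γ hγ with hp | hp
      · have hn : ¬(⟪γ, cascElt K⟫ = 1 ∨ ⟪γ, cascElt K⟫ = 2) := fun h =>
          ctx.pos_not_neg _ hαp ((hN γ hp).2 h)
        rcases hK.inner_cascElt_of_inversions hw hN hp with h | h | h | h
        · linarith
        · linarith
        · exact absurd (Or.inl h) hn
        · exact absurd (Or.inr h) hn
      · have := (hN _ hp).1 (by rwa [map_neg, neg_neg])
        rw [inner_neg_left] at this
        rcases this with h | h <;> linarith
    have hαjϖ : 2 * ⟪αj, ϖ⟫ = ⟪αj, αj⟫ := by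
      have := cartanPairing_mul_inner_self ϖ hαj0
      rw [hϖ αj hαj, if_pos rfl, one_mul, real_inner_comm αj ϖ] at this
      exact this.symm
    have hcoord : ∀ δ ∈ AddSubmonoid.closure (ctx.base : Set V),
        0 ≤ 2 / ⟪αj, αj⟫ * ⟪δ, ϖ⟫ ∧ 2 / ⟪αj, αj⟫ * ⟪δ, ϖ⟫ ≤ ⟪δ, y⟫ := by
      intro δ hδ
      induction hδ using AddSubmonoid.closure_induction with
      | mem α hα =>
        by_cases h : α = αj
        · subst h
          have : 2 / ⟪α, α⟫ * ⟪α, ϖ⟫ = 1 := by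
            rw [div_mul_eq_mul_div, hαjϖ, div_self hnorm.ne']
          rw [this, hαjy]
          norm_num
        · have := cartanPairing_mul_inner_self ϖ
            (ctx.ne_zero_of_mem (ctx.pos_subset (ctx.base_subset hα)))
          rw [hϖ α hα, if_neg h, zero_mul, real_inner_comm α ϖ] at this
          have h0 : ⟪α, ϖ⟫ = 0 := by linarith
          rw [h0, mul_zero]
          exact ⟨le_rfl, hdom α hα⟩
      | zero => simp
      | add a b _ _ ha hb =>
        rw [inner_add_left, inner_add_left, mul_add]
        constructor <;> linarith [ha.1, ha.2, hb.1, hb.2]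
    have hvanish : ∀ δ ∈ ctx.Pos, ⟪δ, y⟫ = 0 → ⟪δ, ϖ⟫ = 0 := by
      intro δ hδ h0
      obtain ⟨h1, h2⟩ := hcoord δ (ctx.pos_coords δ hδ)
      rw [h0] at h2
      have := le_antisymm h2 h1
      exact (mul_eq_zero.1 this).resolve_left (by positivity)
    have hkey := hprop (w.symm ϖ) fun γ hγ h0 => by
      have hy0 : ⟪w γ, y⟫ = 0 := by rw [hwy, h0, neg_zero]
      rw [← hisom, LinearEquiv.apply_symm_apply]
      rcases ctx.pos_or_neg _ ((hroots γ).2 hγ) with h | h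
      · exact hvanish _ h hy0
      · have := hvanish _ h (by rw [inner_neg_left, hy0, neg_zero])
        rwa [inner_neg_left, neg_eq_zero] at this
    have hθϖ : ⟪ctx.θ, w.symm ϖ⟫ = -(⟪αj, αj⟫ / 2) := by
      rw [← hisom, LinearEquiv.apply_symm_apply, hwθ, inner_neg_left]
      linarith
    have hϖy : ϖ = (⟪αj, αj⟫ / 2) • y := by
      have := congrArg w hkey
      rw [LinearEquiv.apply_symm_apply, map_smul, hθϖ] at this
      rw [this, hy, neg_smul, smul_neg]
    rw [hϖy, smul_smul]
    have hone : 2 / ⟪αj, αj⟫ * (⟪αj, αj⟫ / 2) = 1 := by field_simp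
    rw [hone, one_smul]
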